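/- arXiv:2603.16454 — 2 statements merged into one kernel-verified Lean document; each statement's English description precedes it below -/
import Mathlib

section
/- For every C > 0 and every ε > 0 there exists N such that for all n ≥ N and all integers k with |k − 2·log₂ n| ≤ C·log log n: C(n,k)·Σ_{j=1}^{k−1} C(k,j)·C(n−k, k−j)·2^{−2·C(k,2) + C(j,2)} ≤ n^{−1+ε}·(μ² + μ), where μ = C(n,k)·2^{−C(k,2)}. -/
/-- `E[Y_k] = C(n,k)·2^{-C(k,2)}`, the expected number of independent `k`-sets
in `G_{n,1/2}`. -/
noncomputable def expY (n k : ℕ) : ℝ := (n.choose k : ℝ) / 2 ^ (k.choose 2)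

theorem pow_mul_choose_sub_le {n k : ℕ} (hkn : k ≤ n) (j : ℕ) (hj : j ≤ k) :
    n ^ j * (n - j).choose (k - j) ≤ k ^ j * n.choose k := by
  induction j with
  | zero => simp
  | succ j ih =>
    have ih := ih (by omega)
    obtain ⟨a, rfl⟩ : ∃ a, k = a + j + 1 := ⟨k - j - 1, by omega⟩
    obtain ⟨b, rfl⟩ : ∃ b, n = b + j + 1 := ⟨n - j - 1, by omega⟩
    have e1 : a + j + 1 - j = a + 1 := by omega
    have e2 : b + j + 1 - j = b + 1 := by omega
    have e3 : a + j + 1 - (j + 1) = a := by omega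
    have e4 : b + j + 1 - (j + 1) = b := by omega
    rw [e1, e2] at ih
    rw [e3, e4]
    have h1 : (b + 1) * b.choose a = (b + 1).choose (a + 1) * (a + 1) :=
      Nat.add_one_mul_choose_eq b a
    have h2 : (b + j + 1) * (a + 1) ≤ (a + j + 1) * (b + 1) := by
      have : a ≤ b := by omega
      nlinarith
    have h3 : (b + j + 1) * b.choose a ≤ (a + j + 1) * (b + 1).choose (a + 1) := by
      refine le_of_mul_le_mul_left ?_ (Nat.add_one_pos b)
      calc (b + 1) * ((b + j + 1) * b.choose a)
          = (b + j + 1) * ((b + 1) * b.choose a) := by ring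
        _ = ((b + j + 1) * (a + 1)) * (b + 1).choose (a + 1) := by rw [h1]; ring
        _ ≤ ((a + j + 1) * (b + 1)) * (b + 1).choose (a + 1) := Nat.mul_le_mul_right _ h2
        _ = _ := by ring
    calc (b + j + 1) ^ (j + 1) * b.choose a
        = (b + j + 1) ^ j * ((b + j + 1) * b.choose a) := by ring
      _ ≤ (b + j + 1) ^ j * ((a + j + 1) * (b + 1).choose (a + 1)) := Nat.mul_le_mul_left _ h3
      _ = (a + j + 1) * ((b + j + 1) ^ j * (b + 1).choose (a + 1)) := by ring
      _ ≤ (a + j + 1) * ((a + j + 1) ^ j * (b + j + 1).choose (a + j + 1)) :=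
        Nat.mul_le_mul_left _ ih
      _ = _ := by ring

theorem choose_sub_le_div_pow_mul_choose {n k j : ℕ} (hn : 0 < n) (hkn : k ≤ n) (hj : j ≤ k) :
    ((n - k).choose (k - j) : ℝ) ≤ ((k : ℝ) / n) ^ j * n.choose k := by
  have h : n ^ j * (n - k).choose (k - j) ≤ k ^ j * n.choose k :=
    (Nat.mul_le_mul_left _ (Nat.choose_le_choose _ (by omega))).trans
      (pow_mul_choose_sub_le hkn j hj)
  have h' : (n : ℝ) ^ j * (n - k).choose (k - j) ≤ (k : ℝ) ^ j * n.choose k := by exact_mod_cast h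
  rw [div_pow, div_mul_eq_mul_div, le_div_iff₀ (by positivity)]
  linarith

theorem sq_choose_overlap_le {n k j : ℕ} {δ : ℝ} (hn : 1 ≤ n) (hkn : k ≤ n) (hδ0 : 0 < δ)
    (hδ : δ ≤ 1 / 10) (hk : (k : ℝ) ≤ (n : ℝ) ^ δ) (hup : (2 : ℝ) ^ (k : ℝ) ≤ (n : ℝ) ^ (2 + δ))
    (hj : 1 ≤ j) (hjk : 2 * j ≤ k) :
    (k.choose j : ℝ) * ((n - k).choose (k - j) : ℝ) * (2 : ℝ) ^ (j.choose 2 : ℝ) ≤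
      (n : ℝ) ^ (-1 + 6 * δ) * n.choose k := by
  have hx : (1 : ℝ) ≤ n := by exact_mod_cast hn
  have hx0 : (0 : ℝ) < n := by linarith
  set x : ℝ := (n : ℝ)
  have hch : (k.choose j : ℝ) ≤ (k : ℝ) ^ j := by exact_mod_cast Nat.choose_le_pow k j
  have ha : (k : ℝ) * (k / x) ≤ x ^ (2 * δ - 1) := by
    calc (k : ℝ) * (k / x) = k * k / x := by ring
      _ ≤ x ^ δ * x ^ δ / x := by gcongr
      _ = x ^ (2 * δ - 1) := by
        rw [← Real.rpow_add hx0, Real.rpow_sub_one hx0.ne']; ring_nf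
  have key : ((k : ℝ) * (k / x)) ^ j * (2 : ℝ) ^ (j.choose 2 : ℝ) ≤ x ^ (-1 + 6 * δ) := by
    rcases hj.eq_or_lt with rfl | hj2
    · simp only [pow_one, Nat.choose_succ_self, Nat.cast_zero, Real.rpow_zero, mul_one]
      exact ha.trans (Real.rpow_le_rpow_of_exponent_le hx (by linarith))
    · have hs : (2 : ℝ) ^ (j.choose 2 : ℝ) ≤ (x ^ ((2 + δ) / 4)) ^ j := by
        calc (2 : ℝ) ^ (j.choose 2 : ℝ) ≤ (2 : ℝ) ^ ((k : ℝ) * (1 / 4) * j) := by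
              refine Real.rpow_le_rpow_of_exponent_le (by norm_num) ?_
              rw [Nat.cast_choose_two]
              have : (2 : ℝ) * j ≤ k := by exact_mod_cast hjk
              have : (0 : ℝ) ≤ j := by positivity
              nlinarith
          _ = (((2 : ℝ) ^ (k : ℝ)) ^ (1 / 4 : ℝ)) ^ j := by
              rw [Real.rpow_mul (by norm_num), Real.rpow_mul (by norm_num), Real.rpow_natCast]
          _ ≤ ((x ^ (2 + δ)) ^ (1 / 4 : ℝ)) ^ j := by gcongr
          _ = _ := by rw [← Real.rpow_mul hx0.le]; ring_nf
      calc ((k : ℝ) * (k / x)) ^ j * (2 : ℝ) ^ (j.choose 2 : ℝ)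
          ≤ (x ^ (2 * δ - 1)) ^ j * (x ^ ((2 + δ) / 4)) ^ j := by gcongr
        _ = (x ^ (2 * δ - 1 + (2 + δ) / 4)) ^ j := by rw [← mul_pow, ← Real.rpow_add hx0]
        _ ≤ (x ^ (2 * δ - 1 + (2 + δ) / 4)) ^ 2 :=
            pow_le_pow_of_le_one (by positivity)
              (Real.rpow_le_one_of_one_le_of_nonpos hx (by linarith)) hj2
        _ = x ^ ((2 * δ - 1 + (2 + δ) / 4) * 2) := by
            rw [Real.rpow_mul hx0.le]; norm_cast
        _ ≤ _ := Real.rpow_le_rpow_of_exponent_le hx (by linarith)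
  calc (k.choose j : ℝ) * ((n - k).choose (k - j) : ℝ) * (2 : ℝ) ^ (j.choose 2 : ℝ)
      ≤ (k : ℝ) ^ j * ((k / x) ^ j * n.choose k) * (2 : ℝ) ^ (j.choose 2 : ℝ) := by
        gcongr
        exact choose_sub_le_div_pow_mul_choose hn hkn (by omega)
    _ = ((k : ℝ) * (k / x)) ^ j * (2 : ℝ) ^ (j.choose 2 : ℝ) * n.choose k := by
        rw [mul_pow]; ring
    _ ≤ _ := by gcongr

theorem large_overlap_le {n k i : ℕ} {δ : ℝ} (hn : 1 ≤ n) (hδ0 : 0 < δ)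
    (hδ : δ ≤ 1 / 10) (hk : (k : ℝ) ≤ (n : ℝ) ^ δ) (hlo : (n : ℝ) ^ (2 - δ) ≤ (2 : ℝ) ^ (k : ℝ))
    (h2 : 2 ≤ (n : ℝ) ^ δ) (hi : 1 ≤ i) (hik : 2 * i ≤ k) :
    (k.choose (k - i) : ℝ) * ((n - k).choose i : ℝ) *
        (2 : ℝ) ^ (((k - i).choose 2 : ℝ) - (k.choose 2 : ℝ)) ≤
      (n : ℝ) ^ (-1 + 6 * δ) := by
  have hx : (1 : ℝ) ≤ n := by exact_mod_cast hn
  have hx0 : (0 : ℝ) < n := by linarith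
  have hik' : (2 : ℝ) * i ≤ k := by exact_mod_cast hik
  have hi' : (1 : ℝ) ≤ i := by exact_mod_cast hi
  have hch : (k.choose (k - i) : ℝ) ≤ (k : ℝ) ^ i := by
    rw [Nat.choose_symm (by omega)]
    exact_mod_cast Nat.choose_le_pow k i
  have hch2 : ((n - k).choose i : ℝ) ≤ (n : ℝ) ^ i := by
    exact_mod_cast (Nat.choose_le_pow (n - k) i).trans (Nat.pow_le_pow_left (by omega) i)
  have hexp : ((k - i).choose 2 : ℝ) - (k.choose 2 : ℝ) = -(i * (2 * k - i - 1) / 2 : ℝ) := by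
    rw [Nat.cast_choose_two, Nat.cast_choose_two, Nat.cast_sub (by omega)]; ring
  rw [hexp]
  set x : ℝ := (n : ℝ)
  have hneg : ∀ c : ℝ, 0 ≤ c → (2 : ℝ) ^ (-(c * k)) ≤ x ^ (-(c * (2 - δ))) := by
    intro c hc
    calc (2 : ℝ) ^ (-(c * k)) = (((2 : ℝ) ^ (k : ℝ)) ^ c)⁻¹ := by
          rw [Real.rpow_neg (by norm_num), ← Real.rpow_mul (by norm_num)]; ring_nf
      _ ≤ ((x ^ (2 - δ)) ^ c)⁻¹ := by gcongr
      _ = _ := by rw [Real.rpow_neg hx0.le, ← Real.rpow_mul hx0.le]; ring_nf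
  have hbase : ∀ c d : ℝ, 0 ≤ c → d ≤ 1 →
      (k : ℝ) * x * (2 : ℝ) ^ (-(c * k) + d) ≤ x ^ (2 * δ + 1 - c * (2 - δ)) := by
    intro c d hc hd
    calc (k : ℝ) * x * (2 : ℝ) ^ (-(c * k) + d)
        = (k : ℝ) * x * ((2 : ℝ) ^ (-(c * k)) * 2 ^ d) := by
          rw [Real.rpow_add (by norm_num)]
      _ ≤ x ^ δ * x * (x ^ (-(c * (2 - δ))) * x ^ δ) := by
          have : (2 : ℝ) ^ d ≤ x ^ δ :=
            (Real.rpow_le_rpow_of_exponent_le (by norm_num) hd).trans (by simpa using h2)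
          gcongr
          exact hneg c hc
      _ = x ^ δ * x ^ (1 : ℝ) * (x ^ (-(c * (2 - δ))) * x ^ δ) := by rw [Real.rpow_one]
      _ = _ := by
          rw [← Real.rpow_add hx0, ← Real.rpow_add hx0, ← Real.rpow_add hx0]; ring_nf
  calc (k.choose (k - i) : ℝ) * ((n - k).choose i : ℝ) * (2 : ℝ) ^ (-(i * (2 * k - i - 1) / 2 : ℝ))
      ≤ (k : ℝ) ^ i * x ^ i * (2 : ℝ) ^ (-(i * (2 * k - i - 1) / 2 : ℝ)) := by gcongr
    _ ≤ x ^ (-1 + 6 * δ) := ?_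
  rcases hi.eq_or_lt with rfl | hi2
  · have := hbase 1 1 (by norm_num) le_rfl
    have e : (-((1 : ℕ) * (2 * k - (1 : ℕ) - 1) / 2 : ℝ)) = -(1 * (k : ℝ)) + 1 := by
      push_cast; ring
    rw [e, pow_one, pow_one]
    exact this.trans (Real.rpow_le_rpow_of_exponent_le hx (by linarith))
  · have hb := hbase (3 / 4) (1 / 2) (by norm_num) (by norm_num)
    calc (k : ℝ) ^ i * x ^ i * (2 : ℝ) ^ (-(i * (2 * k - i - 1) / 2 : ℝ))
        ≤ (k : ℝ) ^ i * x ^ i * (2 : ℝ) ^ ((-(3 / 4 * (k : ℝ)) + 1 / 2) * i) := by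
          gcongr
          · norm_num
          · nlinarith
      _ = ((k : ℝ) * x * (2 : ℝ) ^ (-(3 / 4 * (k : ℝ)) + 1 / 2)) ^ i := by
          rw [mul_pow, mul_pow, Real.rpow_mul (by norm_num), Real.rpow_natCast]
      _ ≤ (x ^ (2 * δ + 1 - 3 / 4 * (2 - δ))) ^ i := by gcongr
      _ ≤ (x ^ (2 * δ + 1 - 3 / 4 * (2 - δ))) ^ 2 :=
            pow_le_pow_of_le_one (by positivity)
              (Real.rpow_le_one_of_one_le_of_nonpos hx (by linarith)) hi2
      _ = x ^ ((2 * δ + 1 - 3 / 4 * (2 - δ)) * 2) := by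
            rw [Real.rpow_mul hx0.le]; norm_cast
      _ ≤ _ := Real.rpow_le_rpow_of_exponent_le hx (by linarith)

theorem overlap_sum_le {n k : ℕ} {δ : ℝ} (hn : 1 ≤ n) (hkn : k ≤ n) (hδ0 : 0 < δ)
    (hδ : δ ≤ 1 / 10) (hk : (k : ℝ) ≤ (n : ℝ) ^ δ) (hup : (2 : ℝ) ^ (k : ℝ) ≤ (n : ℝ) ^ (2 + δ))
    (hlo : (n : ℝ) ^ (2 - δ) ≤ (2 : ℝ) ^ (k : ℝ)) (h2 : 2 ≤ (n : ℝ) ^ δ) :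
    (n.choose k : ℝ) * ∑ j ∈ Finset.Icc 1 (k - 1),
        (k.choose j : ℝ) * ((n - k).choose (k - j) : ℝ) *
          (2 : ℝ) ^ ((j.choose 2 : ℝ) - 2 * (k.choose 2 : ℝ)) ≤
      (n : ℝ) ^ (-1 + 7 * δ) * (expY n k ^ 2 + expY n k) := by
  have hx0 : (0 : ℝ) < n := by exact_mod_cast hn
  have hμ0 : 0 ≤ expY n k := by unfold expY; positivity
  have hμ : expY n k = n.choose k * (2 : ℝ) ^ (-(k.choose 2 : ℝ)) := by
    rw [expY, Real.rpow_neg (by norm_num), Real.rpow_natCast, div_eq_mul_inv]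
  have hterm : ∀ j ∈ Finset.Icc 1 (k - 1),
      (n.choose k : ℝ) * ((k.choose j : ℝ) * ((n - k).choose (k - j) : ℝ) *
          (2 : ℝ) ^ ((j.choose 2 : ℝ) - 2 * (k.choose 2 : ℝ))) ≤
      (n : ℝ) ^ (-1 + 6 * δ) * (expY n k ^ 2 + expY n k) := by
    intro j hj
    rw [Finset.mem_Icc] at hj
    rcases le_total (2 * j) k with hjk | hjk
    · have h := sq_choose_overlap_le hn hkn hδ0 hδ hk hup hj.1 hjk
      have e : (2 : ℝ) ^ ((j.choose 2 : ℝ) - 2 * (k.choose 2 : ℝ)) =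
          (2 : ℝ) ^ (j.choose 2 : ℝ) *
            ((2 : ℝ) ^ (-(k.choose 2 : ℝ)) * (2 : ℝ) ^ (-(k.choose 2 : ℝ))) := by
        rw [← Real.rpow_add (by norm_num), ← Real.rpow_add (by norm_num)]; ring_nf
      calc _ = n.choose k * ((2 : ℝ) ^ (-(k.choose 2 : ℝ)) * (2 : ℝ) ^ (-(k.choose 2 : ℝ))) *
            ((k.choose j : ℝ) * ((n - k).choose (k - j) : ℝ) * (2 : ℝ) ^ (j.choose 2 : ℝ)) := by
              rw [e]; ring
        _ ≤ n.choose k * ((2 : ℝ) ^ (-(k.choose 2 : ℝ)) * (2 : ℝ) ^ (-(k.choose 2 : ℝ))) *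
            ((n : ℝ) ^ (-1 + 6 * δ) * n.choose k) := by gcongr
        _ = (n : ℝ) ^ (-1 + 6 * δ) * expY n k ^ 2 := by rw [hμ]; ring
        _ ≤ _ := by gcongr; linarith
    · have h := large_overlap_le (i := k - j) hn hδ0 hδ hk hlo h2 (by omega) (by omega)
      rw [Nat.sub_sub_self (by omega)] at h
      have e : (2 : ℝ) ^ ((j.choose 2 : ℝ) - 2 * (k.choose 2 : ℝ)) =
          (2 : ℝ) ^ (-(k.choose 2 : ℝ)) * (2 : ℝ) ^ ((j.choose 2 : ℝ) - (k.choose 2 : ℝ)) := by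
        rw [← Real.rpow_add (by norm_num)]; ring_nf
      calc _ = expY n k * ((k.choose j : ℝ) * ((n - k).choose (k - j) : ℝ) *
              (2 : ℝ) ^ ((j.choose 2 : ℝ) - (k.choose 2 : ℝ))) := by rw [e, hμ]; ring
        _ ≤ expY n k * (n : ℝ) ^ (-1 + 6 * δ) := by gcongr
        _ = (n : ℝ) ^ (-1 + 6 * δ) * expY n k := by ring
        _ ≤ _ := by gcongr; nlinarith
  rw [Finset.mul_sum]
  calc _ ≤ ∑ _j ∈ Finset.Icc 1 (k - 1), (n : ℝ) ^ (-1 + 6 * δ) * (expY n k ^ 2 + expY n k) :=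
        Finset.sum_le_sum hterm
    _ = ((k - 1 : ℕ) : ℝ) * ((n : ℝ) ^ (-1 + 6 * δ) * (expY n k ^ 2 + expY n k)) := by
        rw [Finset.sum_const, Nat.card_Icc, nsmul_eq_mul, Nat.add_sub_cancel]
    _ ≤ (n : ℝ) ^ δ * ((n : ℝ) ^ (-1 + 6 * δ) * (expY n k ^ 2 + expY n k)) := by
        gcongr
        exact le_trans (by exact_mod_cast Nat.sub_le k 1) hk
    _ = _ := by
        rw [← mul_assoc, ← Real.rpow_add hx0]; ring_nf

theorem stmt6 (C ε : ℝ) (hC : 0 < C) (hε : 0 < ε) :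
    ∃ N : ℕ, ∀ n : ℕ, N ≤ n → ∀ k : ℕ,
      |(k : ℝ) - 2 * Real.logb 2 n| ≤ C * Real.log (Real.log n) →
      (n.choose k : ℝ) * ∑ j ∈ Finset.Icc 1 (k - 1),
          (k.choose j : ℝ) * ((n - k).choose (k - j) : ℝ) *
            (2 : ℝ) ^ ((j.choose 2 : ℝ) - 2 * (k.choose 2 : ℝ)) ≤
        (n : ℝ) ^ (-1 + ε) * (expY n k ^ 2 + expY n k) := by
  obtain ⟨δ, hδ0, hδ, hδε⟩ : ∃ δ : ℝ, 0 < δ ∧ δ ≤ 1 / 10 ∧ 7 * δ ≤ ε :=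
    ⟨min (1 / 10) (ε / 7), by positivity, min_le_left _ _, by
      linarith [min_le_right (1 / 10) (ε / 7)]⟩
  have hlog2 : 0 < Real.log 2 := Real.log_pos (by norm_num)
  have hloglog : ∀ᶠ x : ℝ in Filter.atTop, C * Real.log (Real.log x) ≤ δ * Real.logb 2 x := by
    filter_upwards [Real.tendsto_log_atTop.eventually
      (Real.isLittleO_log_id_atTop.bound (show 0 < δ / Real.log 2 / C by positivity)),
      Real.tendsto_log_atTop.eventually_ge_atTop 0] with x h hx
    rw [id, Real.norm_eq_abs, Real.norm_of_nonneg hx] at h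
    calc C * Real.log (Real.log x) ≤ C * (δ / Real.log 2 / C * Real.log x) := by
          gcongr; exact (le_abs_self _).trans h
      _ = _ := by unfold Real.logb; field_simp
  have hlogpow : ∀ᶠ x : ℝ in Filter.atTop, (2 + δ) * Real.logb 2 x ≤ x ^ δ := by
    filter_upwards [(isLittleO_log_rpow_atTop hδ0).bound
      (show 0 < Real.log 2 / (2 + δ) by positivity), Filter.eventually_ge_atTop 0] with x h hx
    rw [Real.norm_eq_abs, Real.norm_of_nonneg (by positivity)] at h
    calc (2 + δ) * Real.logb 2 x = (2 + δ) / Real.log 2 * Real.log x := by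
          unfold Real.logb; ring
      _ ≤ (2 + δ) / Real.log 2 * (Real.log 2 / (2 + δ) * x ^ δ) := by
          gcongr; exact (le_abs_self _).trans h
      _ = _ := by field_simp
  obtain ⟨N, hN⟩ := Filter.eventually_atTop.1 <| tendsto_natCast_atTop_atTop.eventually
    (hloglog.and (hlogpow.and
      ((tendsto_rpow_atTop hδ0).eventually_ge_atTop 2 |>.and (Filter.eventually_ge_atTop 1))))
  refine ⟨N, fun n hn k hk => ?_⟩
  obtain ⟨h1, h2, h3, h4⟩ := hN n hn
  have hx0 : (0 : ℝ) < n := by linarith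
  have hn1 : 1 ≤ n := by exact_mod_cast h4
  obtain ⟨hl, hu⟩ := abs_le.1 (hk.trans h1)
  have hpow : ∀ c : ℝ, (n : ℝ) ^ c = (2 : ℝ) ^ (c * Real.logb 2 n) := by
    intro c
    rw [mul_comm, Real.rpow_mul (by norm_num), Real.rpow_logb (by norm_num) (by norm_num) hx0]
  have hkδ : (k : ℝ) ≤ (n : ℝ) ^ δ := by linarith
  have hkn : k ≤ n := by
    have : (n : ℝ) ^ δ ≤ (n : ℝ) ^ (1 : ℝ) :=
      Real.rpow_le_rpow_of_exponent_le h4 (by linarith)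
    rw [Real.rpow_one] at this
    exact_mod_cast hkδ.trans this
  have hμ0 : 0 ≤ expY n k := by unfold expY; positivity
  refine (overlap_sum_le hn1 hkn hδ0 hδ hkδ ?_ ?_ h3).trans ?_
  · rw [hpow]
    exact Real.rpow_le_rpow_of_exponent_le (by norm_num) (by linarith)
  · rw [hpow]
    exact Real.rpow_le_rpow_of_exponent_le (by norm_num) (by linarith)
  · gcongr
end

section
/- For every C > 0 and every ε > 0 there exist δ > 0 and N such that for all n ≥ N, all integers k with |k − 2·log₂ n| ≤ C·log log n, and all integers i with 0 ≤ i ≤ δ·(log n)/(log log n): d_TV(Z_{k,i}, Poisson(λ)) ≤ n^{−1+ε}·(λ² + λ), where λ = E[Z_{k,i}] = C(n,k)·C(C(k,2), i)·2^{−C(k,2)}. -/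
open scoped Classical

/-- Probability of an event under the uniform measure on simple graphs on `Fin n`
(equivalently, `G_{n,1/2}`). -/
noncomputable def grPr (n : ℕ) (S : Set (SimpleGraph (Fin n))) : ℝ :=
  ((PMF.uniformOfFintype (SimpleGraph (Fin n))).toOuterMeasure S).toReal

/-- Number of edges of `G` with both endpoints in `s`. -/
noncomputable def edgesIn {n : ℕ} (G : SimpleGraph (Fin n)) (s : Finset (Fin n)) : ℕ :=
  {e ∈ G.edgeSet | ∀ v ∈ e, v ∈ s}.ncard

/-- `Z_{k,i}(G)`: the number of `k`-element vertex subsets inducing exactly `i` edges. -/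
noncomputable def numZ (n k i : ℕ) (G : SimpleGraph (Fin n)) : ℕ :=
  (((Finset.univ : Finset (Fin n)).powersetCard k).filter (fun s => edgesIn G s = i)).card

/-- `E[Z_{k,i}] = C(n,k)·C(C(k,2),i)·2^{-C(k,2)}`. -/
noncomputable def expZ (n k i : ℕ) : ℝ :=
  (n.choose k : ℝ) * ((k.choose 2).choose i : ℝ) / 2 ^ (k.choose 2)

/-- Total variation distance between an ℕ-valued graph statistic under `G_{n,1/2}`
and a Poisson distribution of mean `lam`:
`d_TV(X, Poisson(λ)) = Σ_t |P(X = t) − e^{−λ}λ^t/t!|`. -/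
noncomputable def dTVPoisson (n : ℕ) (X : SimpleGraph (Fin n) → ℕ) (lam : ℝ) : ℝ :=
  ∑' t : ℕ, |grPr n {G | X G = t} - Real.exp (-lam) * lam ^ t / t.factorial|

/-- The Poisson weight `e^{-r} r^t / t!`. -/
noncomputable def poissonWeight (r : ℝ) (t : ℕ) : ℝ :=
  Real.exp (-r) * r ^ t / t.factorial

lemma poissonWeight_pos {r : ℝ} (hr : 0 < r) (t : ℕ) : 0 < poissonWeight r t := by
  unfold poissonWeight; positivity

lemma poissonWeight_succ (r : ℝ) (t : ℕ) :
    ((t : ℝ) + 1) * poissonWeight r (t + 1) = r * poissonWeight r t := by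
  unfold poissonWeight
  rw [Nat.factorial_succ]
  push_cast
  have : (t.factorial : ℝ) ≠ 0 := by positivity
  field_simp
  ring

lemma hasSum_poissonWeight (r : ℝ) : HasSum (poissonWeight r) 1 := by
  have h := (NormedSpace.expSeries_div_hasSum_exp r).mul_left (Real.exp (-r))
  rw [← Real.exp_eq_exp_ℝ, ← Real.exp_add, neg_add_cancel, Real.exp_zero] at h
  exact h.congr_fun fun t => by simp [poissonWeight, mul_div_assoc]

lemma mul_sum_poissonWeight_le {r : ℝ} (hr : 0 < r) (v : ℕ) :
    r * ∑ t ∈ Finset.range (v + 1), poissonWeight r t ≤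
      ((v : ℝ) + 1) * ∑ t ∈ Finset.range (v + 2), poissonWeight r t := by
  rw [Finset.sum_range_succ' _ (v + 1), mul_add, Finset.mul_sum, Finset.mul_sum]
  have h0 := poissonWeight_pos hr 0
  refine le_add_of_le_of_nonneg (Finset.sum_le_sum fun t ht => ?_) (by positivity)
  rw [← poissonWeight_succ]
  have : (t : ℝ) ≤ v := by exact_mod_cast Nat.lt_succ_iff.mp (Finset.mem_range.mp ht)
  have := (poissonWeight_pos hr (t + 1)).le
  gcongr

lemma mul_tsum_poissonWeight_le {r : ℝ} (hr : 0 < r) (v : ℕ) :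
    ((v : ℝ) + 1) * ∑' t, poissonWeight r (t + (v + 2)) ≤
      r * ∑' t, poissonWeight r (t + (v + 1)) := by
  have hs := (hasSum_poissonWeight r).summable
  have hs' (m : ℕ) : Summable fun t => poissonWeight r (t + m) := (summable_nat_add_iff m).2 hs
  rw [← tsum_mul_left, ← tsum_mul_left]
  refine Summable.tsum_le_tsum (fun t => ?_) ((hs' _).mul_left _) ((hs' _).mul_left _)
  rw [← poissonWeight_succ, ← add_assoc]
  have := (poissonWeight_pos hr (t + (v + 1) + 1)).le
  refine mul_le_mul_of_nonneg_right ?_ this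
  push_cast
  have : (0 : ℝ) ≤ t := by positivity
  linarith

/-- Solution of the Stein equation for the Poisson distribution and a bounded test function. -/
lemma exists_stein_solution {r : ℝ} (hr : 0 < r) (f : ℕ → ℝ) (hf : ∀ t, |f t| ≤ 1) :
    ∃ g : ℕ → ℝ,
      (∀ w : ℕ, r * g (w + 1) - w * g w = f w - ∑' t, poissonWeight r t * f t) ∧
      ∀ w : ℕ, |g (w + 2) - g (w + 1)| ≤ 2 := by
  set p := poissonWeight r with hp
  have hpos (t : ℕ) : 0 < p t := poissonWeight_pos hr t
  have hs : Summable p := (hasSum_poissonWeight r).summable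
  have habs (t : ℕ) : |p t * f t| ≤ p t := by
    rw [abs_mul, abs_of_pos (hpos t)]
    exact mul_le_of_le_one_right (hpos t).le (hf t)
  have hsf : Summable fun t => p t * f t :=
    Summable.of_norm_bounded hs habs
  set m := ∑' t, p t * f t with hm
  set S : ℕ → ℝ := fun w => ∑ t ∈ Finset.range (w + 1), p t * (f t - m) with hS
  have hSsucc (w : ℕ) : S (w + 1) = S w + p (w + 1) * (f (w + 1) - m) :=
    Finset.sum_range_succ _ _
  refine ⟨fun w => S (w - 1) / (r * p (w - 1)), fun w => ?_, fun v => ?_⟩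
  · rcases w with _ | w
    · have := (hpos 0).ne'
      simp [hS]
      field_simp
    · have h1 := (hpos (w + 1)).ne'
      have h2 := (hpos w).ne'
      simp only [Nat.add_sub_cancel]
      rw [← poissonWeight_succ r w, ← hp, hSsucc]
      push_cast
      have : (w : ℝ) + 1 ≠ 0 := by positivity
      field_simp
      ring
  · simp only [Nat.add_sub_cancel, show v + 2 - 1 = v + 1 by omega]
    set A := ∑ t ∈ Finset.range (v + 1), p t * f t with hA
    set F := ∑ t ∈ Finset.range (v + 1), p t with hF
    set D := ∑' t, p (t + (v + 2)) * f (t + (v + 2)) with hD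
    set T := ∑' t, p (t + (v + 2)) with hT
    set q := p (v + 1) with hq
    set c := f (v + 1) with hc
    have hq0 : 0 < q := hpos _
    have hmA : m = A + q * c + D := by
      rw [hm, ← hsf.sum_add_tsum_nat_add (v + 2), Finset.sum_range_succ]
    have hFT : F + q + T = 1 := by
      rw [← (hasSum_poissonWeight r).tsum_eq, ← hs.sum_add_tsum_nat_add (v + 2),
        Finset.sum_range_succ]
    have hSv : S v = A - F * m := by
      simp only [hS, mul_sub, Finset.sum_sub_distrib, hA, hF, Finset.sum_mul]
    have hAF : |A| ≤ F :=
      (Finset.abs_sum_le_sum_abs _ _).trans (Finset.sum_le_sum fun t _ => habs t)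
    have hsT : Summable fun t => p (t + (v + 2)) := (summable_nat_add_iff _).2 hs
    have hDT : |D| ≤ T := by
      rw [← Real.norm_eq_abs]
      exact tsum_of_norm_bounded hsT.hasSum fun t => habs _
    have hF0 : 0 ≤ F := (abs_nonneg _).trans hAF
    have hT0 : 0 ≤ T := (abs_nonneg _).trans hDT
    have h1 : r * F ≤ ((v : ℝ) + 1) * (F + q) := by
      have := mul_sum_poissonWeight_le hr v
      rwa [Finset.sum_range_succ _ (v + 1)] at this
    have h2 : ((v : ℝ) + 1) * T ≤ r * (q + T) := by
      refine (mul_tsum_poissonWeight_le hr v).trans_eq ?_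
      congr 1
      have := ((summable_nat_add_iff (v + 1)).2 hs).tsum_eq_zero_add
      rw [this, hT, hq]
      simp only [zero_add, hp]
      congr 2
      ext t
      congr 1
      ring
    have hx : r * p v = ((v : ℝ) + 1) * q := (poissonWeight_succ r v).symm
    rw [hx, hSsucc, hSv, ← hq, ← hc]
    set w : ℝ := (v : ℝ) + 1 with hw
    have hw1 : 1 ≤ w := by simp [hw]
    have key : (A - F * m + q * (c - m)) / (r * q) - (A - F * m) / (w * q) =
        (A * (w * T - r * (q + T)) + q * c * (w * T + r * F) + D * (r * F - w * (F + q)))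
          / (r * w * q) := by
      have hTe : T = 1 - F - q := by linarith
      rw [hmA, hTe]
      field_simp
      ring
    rw [key, abs_div, abs_of_pos (by positivity : 0 < r * w * q), div_le_iff₀ (by positivity)]
    have e1 : |A * (w * T - r * (q + T))| ≤ F * (r * (q + T) - w * T) := by
      rw [abs_mul, abs_of_nonpos (by linarith : w * T - r * (q + T) ≤ 0), neg_sub]
      exact mul_le_mul_of_nonneg_right hAF (by linarith)
    have e2 : |q * c * (w * T + r * F)| ≤ q * (w * T + r * F) := by
      have : 0 ≤ w * T + r * F := by positivity
      rw [abs_mul, abs_of_nonneg this]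
      exact mul_le_mul_of_nonneg_right (habs (v + 1)) this
    have e3 : |D * (r * F - w * (F + q))| ≤ T * (w * (F + q) - r * F) := by
      rw [abs_mul, abs_of_nonpos (by linarith : r * F - w * (F + q) ≤ 0), neg_sub]
      exact mul_le_mul_of_nonneg_right hDT (by linarith)
    refine (abs_add_three _ _ _).trans ((add_le_add_three e1 e2 e3).trans ?_)
    have : w * T + r * F ≤ r := by nlinarith
    calc F * (r * (q + T) - w * T) + q * (w * T + r * F) + T * (w * (F + q) - r * F)
        = 2 * q * (w * T + r * F) := by ring
      _ ≤ 2 * q * r := by gcongr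
      _ ≤ 2 * q * r * w := le_mul_of_one_le_right (by positivity) hw1
      _ = 2 * (r * w * q) := by ring

lemma abs_sub_le_of_step {G : ℕ → ℝ} {K : ℝ} (hG : ∀ w, |G (w + 1) - G w| ≤ K) (y d : ℕ) :
    |G (y + d) - G y| ≤ K * d := by
  induction d with
  | zero => simp
  | succ d ih =>
    have h := abs_sub_le (G (y + (d + 1))) (G (y + d)) (G y)
    have := hG (y + d)
    rw [add_assoc] at this
    push_cast
    linarith

/-- The contribution of one indicator to the Chen–Stein error. -/
lemma abs_stein_term_le {Ω : Type*} [Fintype Ω] (c : Ω → ℝ) (hc : ∀ ω, 0 ≤ c ω)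
    (x V W U : Ω → ℕ) (hx : ∀ ω, x ω ≤ 1) (hWU : ∀ ω, W ω = x ω + U ω)
    (g : ℕ → ℝ) (hg : ∀ w, |g (w + 2) - g (w + 1)| ≤ 2)
    (hind : ∑ ω, c ω * (x ω * g (V ω + 1)) = (∑ ω, c ω * x ω) * ∑ ω, c ω * g (V ω + 1)) :
    |(∑ ω, c ω * x ω) * (∑ ω, c ω * g (V ω + W ω + 1)) - ∑ ω, c ω * (x ω * g (V ω + W ω))| ≤
      2 * ((∑ ω, c ω * x ω) * (∑ ω, c ω * W ω) + ∑ ω, c ω * (x ω * U ω)) := by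
  have hlip (y d : ℕ) : |g (y + d + 1) - g (y + 1)| ≤ 2 * d :=
    abs_sub_le_of_step (G := fun w => g (w + 1)) hg y d
  have hp : 0 ≤ ∑ ω, c ω * x ω := Finset.sum_nonneg fun ω _ => mul_nonneg (hc ω) (by positivity)
  have hsplit : (∑ ω, c ω * x ω) * (∑ ω, c ω * g (V ω + W ω + 1)) -
      ∑ ω, c ω * (x ω * g (V ω + W ω)) =
      (∑ ω, c ω * x ω) * (∑ ω, c ω * (g (V ω + W ω + 1) - g (V ω + 1))) -
      ∑ ω, c ω * (x ω * (g (V ω + U ω + 1) - g (V ω + 1))) := by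
    have : ∀ ω, (x ω : ℝ) * g (V ω + W ω) = x ω * g (V ω + U ω + 1) := by
      intro ω
      rcases Nat.le_one_iff_eq_zero_or_eq_one.mp (hx ω) with h | h
      · simp [h]
      · rw [hWU, h, add_comm 1, add_assoc]
    simp only [this, mul_sub, Finset.sum_sub_distrib, hind]
    ring
  rw [hsplit]
  refine (abs_sub _ _).trans ?_
  rw [abs_mul, abs_of_nonneg hp, mul_add, mul_left_comm, Finset.mul_sum _ _ 2, Finset.mul_sum _ _ 2]
  refine add_le_add (mul_le_mul_of_nonneg_left ?_ hp) ?_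
  · refine (Finset.abs_sum_le_sum_abs _ _).trans (Finset.sum_le_sum fun ω _ => ?_)
    rw [abs_mul, abs_of_nonneg (hc ω), mul_left_comm]
    exact mul_le_mul_of_nonneg_left (hlip _ _) (hc ω)
  · refine (Finset.abs_sum_le_sum_abs _ _).trans (Finset.sum_le_sum fun ω _ => ?_)
    rw [abs_mul, abs_mul, abs_of_nonneg (hc ω), Nat.abs_cast, mul_left_comm 2 (c ω),
      mul_left_comm 2 (x ω : ℝ)]
    have := hc ω
    have := hlip (V ω) (U ω)
    gcongr

/-- Total variation distance is attained against a sign function and thus controlled by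
Stein's equation. -/
lemma tsum_abs_sub_poissonWeight_le {Ω : Type*} [Fintype Ω] (c : Ω → ℝ) (Z : Ω → ℕ) {r K : ℝ}
    (hr : 0 < r)
    (h : ∀ g : ℕ → ℝ, (∀ w, |g (w + 2) - g (w + 1)| ≤ 2) →
      |∑ ω, c ω * (r * g (Z ω + 1) - Z ω * g (Z ω))| ≤ K) (hc : ∑ ω, c ω = 1) :
    ∑' t, |∑ ω with Z ω = t, c ω - poissonWeight r t| ≤ K := by
  set q : ℕ → ℝ := fun t => ∑ ω with Z ω = t, c ω with hq
  set f : ℕ → ℝ := fun t => if poissonWeight r t ≤ q t then 1 else -1 with hf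
  have hf1 (t : ℕ) : |f t| ≤ 1 := by
    simp only [hf]; split_ifs <;> simp
  obtain ⟨g, hg, hg2⟩ := exists_stein_solution hr f hf1
  have habs (t : ℕ) : |q t - poissonWeight r t| = q t * f t - poissonWeight r t * f t := by
    simp only [hf]
    split_ifs with hle
    · rw [abs_of_nonneg (by linarith)]; ring
    · rw [abs_of_neg (by linarith)]; ring
  have hpf : Summable fun t => poissonWeight r t * f t := by
    refine Summable.of_norm_bounded (hasSum_poissonWeight r).summable fun t => ?_
    rw [norm_mul, Real.norm_of_nonneg (poissonWeight_pos hr t).le]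
    exact mul_le_of_le_one_right (poissonWeight_pos hr t).le (hf1 t)
  have hqf : HasSum (fun t => q t * f t) (∑ ω, c ω * f (Z ω)) := by
    have hzero : ∀ t ∉ Finset.univ.image Z, q t * f t = 0 := fun t ht => by
      have : ∀ ω, Z ω ≠ t := fun ω hω => ht (by simp [← hω])
      simp [hq, this]
    have hsum : HasSum (fun t => q t * f t) (∑ t ∈ Finset.univ.image Z, q t * f t) :=
      hasSum_sum_of_ne_finset_zero hzero
    convert hsum using 1
    rw [← Finset.sum_fiberwise_of_maps_to (t := Finset.univ.image Z) (g := Z)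
      (fun ω _ => Finset.mem_image_of_mem Z (Finset.mem_univ ω))]
    refine Finset.sum_congr rfl fun t _ => ?_
    rw [hq, Finset.sum_mul]
    refine Finset.sum_congr rfl fun ω hω => ?_
    rw [(Finset.mem_filter.mp hω).2]
  change ∑' t, |q t - poissonWeight r t| ≤ K
  simp only [habs]
  rw [hqf.summable.tsum_sub hpf, hqf.tsum_eq]
  refine le_trans (le_of_eq ?_) ((le_abs_self _).trans (h g hg2))
  simp only [hg, mul_sub, Finset.sum_sub_distrib]
  rw [← Finset.sum_mul, hc, one_mul]

/-- The Chen–Stein bound for a sum of dissociated indicators. -/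
theorem chen_stein_le {Ω ι : Type*} [Fintype Ω] [DecidableEq ι] (c : Ω → ℝ) (hc : ∀ ω, 0 ≤ c ω)
    (hc1 : ∑ ω, c ω = 1) (I : Finset ι) (X : ι → Ω → ℕ) (hX : ∀ a ω, X a ω ≤ 1)
    (B : ι → Finset ι) (hB : ∀ a ∈ I, a ∈ B a) (hBI : ∀ a ∈ I, B a ⊆ I)
    (hind : ∀ a ∈ I, ∀ h : ℕ → ℝ, ∑ ω, c ω * (X a ω * h (∑ b ∈ I \ B a, X b ω)) =
      (∑ ω, c ω * X a ω) * ∑ ω, c ω * h (∑ b ∈ I \ B a, X b ω))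
    (hr : 0 < ∑ a ∈ I, ∑ ω, c ω * X a ω) :
    ∑' t, |∑ ω with ∑ a ∈ I, X a ω = t, c ω - poissonWeight (∑ a ∈ I, ∑ ω, c ω * X a ω) t| ≤
      2 * ∑ a ∈ I, ((∑ ω, c ω * X a ω) * (∑ b ∈ B a, ∑ ω, c ω * X b ω) +
        ∑ b ∈ (B a).erase a, ∑ ω, c ω * (X a ω * X b ω)) := by
  refine tsum_abs_sub_poissonWeight_le c _ hr (fun g hg => ?_) hc1
  have hterm : ∀ a ∈ I, _ := fun a ha => abs_stein_term_le c hc (X a)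
    (fun ω => ∑ b ∈ I \ B a, X b ω) (fun ω => ∑ b ∈ B a, X b ω)
    (fun ω => ∑ b ∈ (B a).erase a, X b ω) (hX a)
    (fun ω => (Finset.add_sum_erase (B a) (fun b => X b ω) (hB a ha)).symm) g hg
    (hind a ha fun w => g (w + 1))
  have heq : ∑ ω, c ω * ((∑ a ∈ I, ∑ ω, c ω * X a ω) * g (∑ a ∈ I, X a ω + 1) -
      ((∑ a ∈ I, X a ω : ℕ) : ℝ) * g (∑ a ∈ I, X a ω)) =
      ∑ a ∈ I, ((∑ ω, c ω * X a ω) * (∑ ω, c ω * g (∑ a ∈ I, X a ω + 1)) -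
        ∑ ω, c ω * (X a ω * g (∑ a ∈ I, X a ω))) := by
    rw [Finset.sum_sub_distrib, ← Finset.sum_mul, Finset.sum_comm (s := I) (t := Finset.univ)
      (f := fun a ω => c ω * (X a ω * g (∑ a ∈ I, X a ω))), Finset.mul_sum,
      ← Finset.sum_sub_distrib]
    refine Finset.sum_congr rfl fun ω _ => ?_
    rw [← Finset.mul_sum, ← Finset.sum_mul]
    push_cast
    ring
  rw [heq, Finset.mul_sum]
  refine (Finset.abs_sum_le_sum_abs _ _).trans (Finset.sum_le_sum fun a ha => ?_)
  have := hterm a ha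
  simp only [Finset.sum_sdiff (hBI a ha), Nat.cast_sum, Finset.mul_sum] at this ⊢
  rw [Finset.sum_comm (s := B a), Finset.sum_comm (s := (B a).erase a)]
  simpa only [Finset.mul_sum] using this


/-- The edge set of a graph, as a finset of unordered pairs. -/
noncomputable def edges {n : ℕ} (G : SimpleGraph (Fin n)) : Finset (Sym2 (Fin n)) :=
  Finset.univ.filter fun e => e ∈ G.edgeSet

/-- The unordered pairs of distinct elements of `s`. -/
noncomputable def pairs {n : ℕ} (s : Finset (Fin n)) : Finset (Sym2 (Fin n)) :=
  Finset.univ.filter fun e => ¬e.IsDiag ∧ ∀ v ∈ e, v ∈ s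

lemma mem_edges {n : ℕ} {G : SimpleGraph (Fin n)} {e : Sym2 (Fin n)} :
    e ∈ edges G ↔ e ∈ G.edgeSet := by simp [edges]

lemma mem_pairs {n : ℕ} {s : Finset (Fin n)} {e : Sym2 (Fin n)} :
    e ∈ pairs s ↔ ¬e.IsDiag ∧ ∀ v ∈ e, v ∈ s := by simp [pairs]

lemma card_pairs {n : ℕ} (s : Finset (Fin n)) : (pairs s).card = s.card.choose 2 := by
  rw [← Sym2.card_image_offDiag]
  congr 1
  ext e
  induction e with | _ x y => ?_
  simp only [mem_pairs, Finset.mem_image, Finset.mem_offDiag, Prod.exists, Sym2.mem_iff,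
    Sym2.mk_isDiag_iff, forall_eq_or_imp, forall_eq]
  constructor
  · rintro ⟨h, hx, hy⟩
    exact ⟨x, y, ⟨hx, hy, h⟩, rfl⟩
  · rintro ⟨a, b, ⟨ha, hb, hab⟩, h⟩
    rcases Sym2.eq_iff.mp h with ⟨rfl, rfl⟩ | ⟨rfl, rfl⟩
    · exact ⟨hab, ha, hb⟩
    · exact ⟨Ne.symm hab, hb, ha⟩

lemma pairs_subset_univ {n : ℕ} (s : Finset (Fin n)) : pairs s ⊆ pairs Finset.univ := by
  intro e he
  simp only [mem_pairs, Finset.mem_univ, implies_true, and_true] at he ⊢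
  exact he.1

lemma pairs_inter {n : ℕ} (s t : Finset (Fin n)) : pairs s ∩ pairs t = pairs (s ∩ t) := by
  ext e
  simp only [Finset.mem_inter, mem_pairs]
  grind

lemma edgesIn_eq {n : ℕ} (G : SimpleGraph (Fin n)) (s : Finset (Fin n)) :
    edgesIn G s = (edges G ∩ pairs s).card := by
  rw [edgesIn, ← Set.ncard_coe_finset]
  congr 1
  ext e
  simp only [Set.mem_ofPred_eq, Finset.coe_inter, Set.mem_inter_iff, Finset.mem_coe, mem_edges,
    mem_pairs]
  exact ⟨fun h => ⟨h.1, G.not_isDiag_of_mem_edgeSet h.1, h.2⟩, fun h => ⟨h.1, h.2.2⟩⟩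

lemma edges_subset {n : ℕ} (G : SimpleGraph (Fin n)) : edges G ⊆ pairs Finset.univ := by
  intro e he
  simp only [mem_pairs, Finset.mem_univ, implies_true, and_true]
  exact G.not_isDiag_of_mem_edgeSet (mem_edges.mp he)

/-- Summing over graphs factorizes over a set of pairs and its complement. -/
lemma sum_graph_mul {n : ℕ} {A : Finset (Sym2 (Fin n))} (hA : A ⊆ pairs Finset.univ)
    (F H : Finset (Sym2 (Fin n)) → ℝ) :
    ∑ G : SimpleGraph (Fin n), F (edges G ∩ A) * H (edges G \ A) =
      (∑ S ∈ A.powerset, F S) * ∑ T ∈ (pairs Finset.univ \ A).powerset, H T := by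
  have hE (S T : Finset (Sym2 (Fin n))) (hS : S ⊆ A) (hT : T ⊆ pairs Finset.univ \ A) :
      edges (SimpleGraph.fromEdgeSet (↑(S ∪ T) : Set (Sym2 (Fin n)))) = S ∪ T := by
    ext e
    simp only [mem_edges, SimpleGraph.edgeSet_fromEdgeSet, Set.mem_sdiff, Finset.mem_coe,
      Sym2.mem_diagSet]
    refine ⟨fun h => h.1, fun h => ⟨h, ?_⟩⟩
    rcases Finset.mem_union.mp h with h | h
    · exact (mem_pairs.mp (hA (hS h))).1
    · exact (mem_pairs.mp (Finset.mem_sdiff.mp (hT h)).1).1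
  rw [Finset.sum_mul_sum, ← Finset.sum_product']
  refine Finset.sum_bij' (fun G _ => (edges G ∩ A, edges G \ A))
    (fun p _ => SimpleGraph.fromEdgeSet (↑(p.1 ∪ p.2) : Set (Sym2 (Fin n)))) ?_ ?_ ?_ ?_ ?_
  · intro G _
    simp only [Finset.mem_product, Finset.mem_powerset]
    exact ⟨Finset.inter_subset_right, Finset.sdiff_subset_sdiff (edges_subset G) subset_rfl⟩
  · simp
  · intro G _
    have : edges G ∩ A ∪ edges G \ A = edges G := by ext; simp; tauto
    rw [this]
    ext x y
    simp only [SimpleGraph.fromEdgeSet_adj, Finset.mem_coe, mem_edges, SimpleGraph.mem_edgeSet]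
    exact ⟨fun h => h.1, fun h => ⟨h, h.ne⟩⟩
  · rintro ⟨S, T⟩ hST
    simp only [Finset.mem_product, Finset.mem_powerset] at hST
    obtain ⟨hS, hT⟩ := hST
    simp only [hE S T hS hT, Prod.mk.injEq]
    constructor
    · ext e
      have := @hS e
      have := @hT e
      simp only [Finset.mem_inter, Finset.mem_union, Finset.mem_sdiff] at *
      tauto
    · ext e
      have := @hS e
      have := @hT e
      simp only [Finset.mem_union, Finset.mem_sdiff] at *
      tauto
  · simp

/-- The probability of each graph under `G_{n,1/2}`. -/
noncomputable def graphWeight (n : ℕ) : ℝ := (2 ^ n.choose 2)⁻¹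

lemma graphWeight_eq {n : ℕ} {A : Finset (Sym2 (Fin n))} (hA : A ⊆ pairs Finset.univ) :
    graphWeight n = (2 ^ A.card)⁻¹ * (2 ^ (pairs Finset.univ \ A).card)⁻¹ := by
  rw [graphWeight, ← mul_inv, ← pow_add, add_comm, Finset.card_sdiff_add_card_eq_card hA,
    card_pairs, Finset.card_fin]

lemma sum_graph_inter {n : ℕ} {A : Finset (Sym2 (Fin n))} (hA : A ⊆ pairs Finset.univ)
    (F : Finset (Sym2 (Fin n)) → ℝ) :
    ∑ G : SimpleGraph (Fin n), graphWeight n * F (edges G ∩ A) =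
      (∑ S ∈ A.powerset, F S) / 2 ^ A.card := by
  have h := sum_graph_mul hA F fun _ => 1
  simp only [mul_one, Finset.sum_const, Finset.card_powerset, nsmul_eq_mul] at h
  rw [← Finset.mul_sum, h, graphWeight_eq hA]
  push_cast
  field_simp

lemma sum_graph_sdiff {n : ℕ} {A : Finset (Sym2 (Fin n))} (hA : A ⊆ pairs Finset.univ)
    (H : Finset (Sym2 (Fin n)) → ℝ) :
    ∑ G : SimpleGraph (Fin n), graphWeight n * H (edges G \ A) =
      (∑ T ∈ (pairs Finset.univ \ A).powerset, H T) / 2 ^ (pairs Finset.univ \ A).card := by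
  have h := sum_graph_mul hA (fun _ => 1) H
  simp only [one_mul, Finset.sum_const, Finset.card_powerset, nsmul_eq_mul, mul_one] at h
  rw [← Finset.mul_sum, h, graphWeight_eq hA]
  push_cast
  field_simp

lemma sum_graphWeight (n : ℕ) : ∑ _G : SimpleGraph (Fin n), graphWeight n = 1 := by
  have h := sum_graph_inter (n := n) (A := ∅) (Finset.empty_subset _) fun _ => 1
  simpa using h

lemma graphWeight_nonneg (n : ℕ) : 0 ≤ graphWeight n := by unfold graphWeight; positivity

/-- Independence of the edges inside `A` and outside `A`. -/
lemma sum_graph_indep {n : ℕ} {A : Finset (Sym2 (Fin n))} (hA : A ⊆ pairs Finset.univ)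
    (F H : Finset (Sym2 (Fin n)) → ℝ) :
    ∑ G : SimpleGraph (Fin n), graphWeight n * (F (edges G ∩ A) * H (edges G \ A)) =
      (∑ G : SimpleGraph (Fin n), graphWeight n * F (edges G ∩ A)) *
        ∑ G : SimpleGraph (Fin n), graphWeight n * H (edges G \ A) := by
  rw [sum_graph_inter hA, sum_graph_sdiff hA, ← Finset.mul_sum, sum_graph_mul hA,
    graphWeight_eq hA]
  field_simp

lemma grPr_eq (n : ℕ) (X : SimpleGraph (Fin n) → ℕ) (t : ℕ) :
    grPr n {G | X G = t} = ∑ G with X G = t, graphWeight n := by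
  have hcard : (Fintype.card (SimpleGraph (Fin n)) : ℝ)⁻¹ = graphWeight n := by
    have := sum_graphWeight n
    rw [Finset.sum_const, nsmul_eq_mul, Finset.card_univ] at this
    exact inv_eq_of_mul_eq_one_right this
  rw [grPr, PMF.toOuterMeasure_uniformOfFintype_apply, Finset.sum_const, nsmul_eq_mul, ← hcard,
    ENNReal.toReal_div, ENNReal.toReal_natCast, ENNReal.toReal_natCast, div_eq_mul_inv,
    Fintype.card_subtype]
  simp

/-- The indicator that `s` induces exactly `i` edges. -/
noncomputable def inducesInd {n : ℕ} (i : ℕ) (s : Finset (Fin n)) (G : SimpleGraph (Fin n)) : ℕ :=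
  if edgesIn G s = i then 1 else 0

lemma inducesInd_cast {n : ℕ} (i : ℕ) (s : Finset (Fin n)) (G : SimpleGraph (Fin n)) :
    (inducesInd i s G : ℝ) = if (edges G ∩ pairs s).card = i then 1 else 0 := by
  simp [inducesInd, edgesIn_eq]

lemma numZ_eq (n k i : ℕ) (G : SimpleGraph (Fin n)) :
    numZ n k i G = ∑ s ∈ (Finset.univ : Finset (Fin n)).powersetCard k, inducesInd i s G := by
  simp [numZ, inducesInd]

lemma expect_inducesInd {n k : ℕ} (i : ℕ) {s : Finset (Fin n)} (hs : s.card = k) :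
    ∑ G : SimpleGraph (Fin n), graphWeight n * (inducesInd i s G : ℝ) =
      ((k.choose 2).choose i : ℝ) / 2 ^ k.choose 2 := by
  simp only [inducesInd_cast]
  rw [sum_graph_inter (pairs_subset_univ s) fun S => if S.card = i then 1 else 0, card_pairs, hs,
    Finset.sum_boole, ← Finset.powersetCard_eq_filter, Finset.card_powersetCard, card_pairs, hs]

lemma card_filter_powerset_le {α : Type*} (D : Finset α) (i m : ℕ) (hm : 1 ≤ m) (hD : D.card ≤ m) :
    (D.powerset.filter fun S => S.card ≤ i).card ≤ (i + 1) * m ^ i := by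
  have : D.powerset.filter (fun S => S.card ≤ i) ⊆
      (Finset.range (i + 1)).biUnion fun j => D.powersetCard j := by
    intro S hS
    simp only [Finset.mem_filter, Finset.mem_powerset] at hS
    simp only [Finset.mem_biUnion, Finset.mem_range, Finset.mem_powersetCard]
    exact ⟨S.card, Nat.lt_succ_of_le hS.2, hS.1, rfl⟩
  refine (Finset.card_le_card this).trans (Finset.card_biUnion_le.trans ?_)
  refine (Finset.sum_le_card_nsmul _ _ (m ^ i) fun j hj => ?_).trans_eq (by simp)
  rw [Finset.card_powersetCard]
  exact (Nat.choose_le_pow _ _).trans ((Nat.pow_le_pow_left hD j).trans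
    (Nat.pow_le_pow_right hm (Nat.lt_succ_iff.mp (Finset.mem_range.mp hj))))

lemma expect_inducesInd_mul_le {n k : ℕ} (i : ℕ) (hk : 1 ≤ k) {s t : Finset (Fin n)}
    (hs : s.card = k) (ht : t.card = k) :
    ∑ G : SimpleGraph (Fin n), graphWeight n * ((inducesInd i s G : ℝ) * inducesInd i t G) ≤
      ((k.choose 2).choose i : ℝ) / 2 ^ k.choose 2 *
        (((i : ℝ) + 1) * (k ^ 2) ^ i * (2 ^ (s ∩ t).card.choose 2 / 2 ^ k.choose 2)) := by
  have hA := pairs_subset_univ s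
  set D := pairs t \ pairs s with hD
  have hDc : D.card + (s ∩ t).card.choose 2 = k.choose 2 := by
    rw [← card_pairs, ← pairs_inter, Finset.inter_comm, hD, Finset.card_sdiff_add_card_inter,
      card_pairs, ht]
  calc _ ≤ ∑ G : SimpleGraph (Fin n), graphWeight n *
        ((if (edges G ∩ pairs s).card = i then 1 else 0) *
          if ((edges G \ pairs s) ∩ pairs t).card ≤ i then 1 else 0) := by
        refine Finset.sum_le_sum fun G _ => mul_le_mul_of_nonneg_left ?_ (graphWeight_nonneg n)
        simp only [inducesInd_cast]
        refine mul_le_mul_of_nonneg_left ?_ (by split_ifs <;> simp)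
        split_ifs with h1 h2 <;> try simp
        refine absurd ((Finset.card_le_card ?_).trans h1.le) h2
        exact Finset.inter_subset_inter_right Finset.sdiff_subset
    _ = ((k.choose 2).choose i : ℝ) / 2 ^ k.choose 2 *
        ∑ G : SimpleGraph (Fin n), graphWeight n *
          if (edges G ∩ D).card ≤ i then 1 else 0 := by
        rw [sum_graph_indep hA (fun S => if S.card = i then 1 else 0)
          fun T => if (T ∩ pairs t).card ≤ i then 1 else 0, ← expect_inducesInd i hs]
        simp only [inducesInd_cast, hD, Finset.inter_sdiff_assoc, Finset.sdiff_inter_right_comm]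
    _ ≤ _ := by
        rw [sum_graph_inter (Finset.sdiff_subset.trans (pairs_subset_univ t))
          fun S => if S.card ≤ i then 1 else 0, Finset.sum_boole]
        have hcard : ((D.powerset.filter fun S => S.card ≤ i).card : ℝ) ≤
            ((i : ℝ) + 1) * (k ^ 2) ^ i := by
          have := card_filter_powerset_le D i (k ^ 2) (Nat.one_le_pow _ _ hk)
            ((by omega : D.card ≤ k.choose 2).trans (Nat.choose_le_pow _ _))
          exact_mod_cast this
        rw [← hDc, pow_add, div_mul_cancel_right₀ (by positivity), ← div_eq_mul_inv, hDc]
        gcongr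

lemma card_powersetCard_superset_le {n k : ℕ} (L : Finset (Fin n)) :
    (((Finset.univ : Finset (Fin n)).powersetCard k).filter fun b => L ⊆ b).card ≤
      (n - L.card).choose (k - L.card) := by
  have h : ((Finset.univ \ L).powersetCard (k - L.card)).card =
      (n - L.card).choose (k - L.card) := by
    rw [Finset.card_powersetCard, Finset.card_sdiff_of_subset (Finset.subset_univ L),
      Finset.card_fin]
  rw [← h]
  refine Finset.card_le_card_of_injOn (fun b => b \ L) (fun b hb => ?_) fun b hb b' hb' hbb => ?_
  · simp only [Finset.coe_filter, Set.mem_ofPred_eq, Finset.mem_powersetCard] at hb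
    simp only [Finset.mem_coe, Finset.mem_powersetCard]
    exact ⟨Finset.sdiff_subset_sdiff (Finset.subset_univ b) subset_rfl, by
      rw [Finset.card_sdiff_of_subset hb.2, hb.1.2]⟩
  · simp only [Finset.coe_filter, Set.mem_ofPred_eq] at hb hb'
    rw [← Finset.sdiff_union_of_subset hb.2, ← Finset.sdiff_union_of_subset hb'.2]
    exact congrArg (· ∪ L) hbb

/-- An upper bound for the number of `k`-subsets of an `n`-set meeting a given `k`-subset in
exactly `l` points. -/
def overlapCount (n k l : ℕ) : ℕ := k.choose l * (n - l).choose (k - l)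

lemma card_inter_eq_le {n k l : ℕ} {a : Finset (Fin n)} (ha : a.card = k) :
    (((Finset.univ : Finset (Fin n)).powersetCard k).filter fun b => (a ∩ b).card = l).card ≤
      overlapCount n k l := by
  have hsub : (((Finset.univ : Finset (Fin n)).powersetCard k).filter fun b => (a ∩ b).card = l) ⊆
      (a.powersetCard l).biUnion fun L =>
        ((Finset.univ : Finset (Fin n)).powersetCard k).filter fun b => L ⊆ b := by
    intro b hb
    simp only [Finset.mem_filter] at hb
    simp only [Finset.mem_biUnion, Finset.mem_filter, Finset.mem_powersetCard]
    exact ⟨a ∩ b, ⟨Finset.inter_subset_left, hb.2⟩, Finset.mem_powersetCard.mp hb.1,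
      Finset.inter_subset_right⟩
  refine (Finset.card_le_card hsub).trans (Finset.card_biUnion_le.trans ?_)
  refine (Finset.sum_le_card_nsmul _ _ ((n - l).choose (k - l)) fun L hL => ?_).trans_eq ?_
  · have := card_powersetCard_superset_le (k := k) L
    rwa [(Finset.mem_powersetCard.mp hL).2] at this
  · rw [Finset.card_powersetCard, ha, smul_eq_mul, overlapCount]

lemma sum_inter_le {n k : ℕ} {a : Finset (Fin n)} (ha : a.card = k)
    {J : Finset (Finset (Fin n))} (hJ : J ⊆ (Finset.univ : Finset (Fin n)).powersetCard k)
    {T : Finset ℕ} (hT : ∀ b ∈ J, (a ∩ b).card ∈ T) (φ : ℕ → ℝ) (hφ : ∀ l, 0 ≤ φ l) :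
    ∑ b ∈ J, φ (a ∩ b).card ≤ ∑ l ∈ T, (overlapCount n k l : ℝ) * φ l := by
  rw [← Finset.sum_fiberwise_of_maps_to hT]
  refine Finset.sum_le_sum fun l _ => ?_
  rw [Finset.sum_congr rfl fun b hb => by rw [(Finset.mem_filter.mp hb).2], Finset.sum_const,
    nsmul_eq_mul]
  refine mul_le_mul_of_nonneg_right ?_ (hφ l)
  exact_mod_cast (Finset.card_le_card (Finset.filter_subset_filter _ hJ)).trans
    (card_inter_eq_le ha)

lemma sum_graph_dissociated {n : ℕ} (i : ℕ) (a : Finset (Fin n)) (J : Finset (Finset (Fin n)))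
    (hJ : ∀ b ∈ J, (a ∩ b).card ≤ 1) (h : ℕ → ℝ) :
    ∑ G : SimpleGraph (Fin n), graphWeight n *
        (inducesInd i a G * h (∑ b ∈ J, inducesInd i b G)) =
      (∑ G : SimpleGraph (Fin n), graphWeight n * (inducesInd i a G : ℝ)) *
        ∑ G : SimpleGraph (Fin n), graphWeight n * h (∑ b ∈ J, inducesInd i b G) := by
  have hV (G : SimpleGraph (Fin n)) : ∑ b ∈ J, inducesInd i b G =
      ∑ b ∈ J, if ((edges G \ pairs a) ∩ pairs b).card = i then 1 else 0 := by
    refine Finset.sum_congr rfl fun b hb => ?_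
    have hdisj : pairs b \ pairs a = pairs b := by
      rw [Finset.sdiff_eq_self_iff_disjoint, Finset.disjoint_iff_inter_eq_empty, pairs_inter,
        ← Finset.card_eq_zero, card_pairs, Finset.inter_comm]
      exact Nat.choose_eq_zero_of_lt (Nat.lt_succ_of_le (hJ b hb))
    rw [inducesInd, edgesIn_eq, Finset.sdiff_inter_right_comm, Finset.inter_sdiff_assoc, hdisj]
  simp only [hV, inducesInd_cast]
  exact sum_graph_indep (pairs_subset_univ a) (fun S => if S.card = i then 1 else 0)
    fun T => h (∑ b ∈ J, if (T ∩ pairs b).card = i then 1 else 0)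

/-- The Chen–Stein bound for `Z_{k,i}`, in terms of the overlap sums. -/
lemma dTVPoisson_numZ_le {n k i : ℕ} (hk : 2 ≤ k) (hkn : k ≤ n) (hi : i ≤ k.choose 2) :
    dTVPoisson n (numZ n k i) (expZ n k i) ≤
      2 * expZ n k i * (((k.choose 2).choose i : ℝ) / 2 ^ k.choose 2 *
          ∑ l ∈ Finset.Icc 2 k, (overlapCount n k l : ℝ) +
        ((i : ℝ) + 1) * (k ^ 2) ^ i *
          ∑ l ∈ Finset.Ico 2 k, (overlapCount n k l : ℝ) *
            (2 ^ l.choose 2 / 2 ^ k.choose 2)) := by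
  set p : ℝ := ((k.choose 2).choose i : ℝ) / 2 ^ k.choose 2 with hp
  have hp0 : 0 < p := by
    have := Nat.choose_pos hi
    positivity
  set I := (Finset.univ : Finset (Fin n)).powersetCard k with hI
  have hIcard : (I.card : ℝ) = n.choose k := by
    rw [hI, Finset.card_powersetCard, Finset.card_fin]
  have hcard : ∀ a ∈ I, a.card = k := fun a ha => (Finset.mem_powersetCard.mp ha).2
  have hE : ∀ a ∈ I, ∑ G : SimpleGraph (Fin n), graphWeight n * (inducesInd i a G : ℝ) = p :=
    fun a ha => expect_inducesInd i (hcard a ha)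
  have hlam : expZ n k i = n.choose k * p := by rw [expZ, hp, mul_div_assoc]
  have hsum : ∑ a ∈ I, ∑ G : SimpleGraph (Fin n), graphWeight n * (inducesInd i a G : ℝ) =
      expZ n k i := by
    rw [Finset.sum_congr rfl hE, Finset.sum_const, nsmul_eq_mul, hIcard, hlam]
  have hlam0 : 0 < expZ n k i := by
    have := Nat.choose_pos hkn
    rw [hlam]
    positivity
  set B : Finset (Fin n) → Finset (Finset (Fin n)) := fun a => I.filter fun b => 2 ≤ (a ∩ b).card
    with hB
  have hmain := chen_stein_le (fun _ : SimpleGraph (Fin n) => graphWeight n)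
    (fun _ => graphWeight_nonneg n) (sum_graphWeight n) I (fun a G => inducesInd i a G)
    (fun a G => by unfold inducesInd; split_ifs <;> simp) B
    (fun a ha => by simpa [hB, ha, hcard a ha] using hk) (fun a _ => Finset.filter_subset _ _)
    (fun a _ h => sum_graph_dissociated i a _ (fun b hb => by
      simp only [hB, Finset.mem_sdiff, Finset.mem_filter] at hb
      have := hb.2
      simp only [hb.1, true_and] at this
      omega) h) (by rw [hsum]; exact hlam0)
  rw [hsum] at hmain
  have hd : dTVPoisson n (numZ n k i) (expZ n k i) = ∑' t, |∑ G : SimpleGraph (Fin n) with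
      ∑ a ∈ I, inducesInd i a G = t, graphWeight n - poissonWeight (expZ n k i) t| := by
    simp only [dTVPoisson, grPr_eq, numZ_eq, poissonWeight, hI]
  rw [hd]
  refine hmain.trans ?_
  rw [mul_assoc, hlam, ← hIcard, mul_assoc, ← nsmul_eq_mul I.card]
  refine mul_le_mul_of_nonneg_left (Finset.sum_le_card_nsmul _ _ _ fun a ha => ?_) zero_le_two
  rw [hE a ha, mul_add]
  refine add_le_add (mul_le_mul_of_nonneg_left ?_ hp0.le) ?_
  · rw [Finset.sum_congr rfl fun b hb => hE b (Finset.mem_filter.mp hb).1, Finset.mul_sum]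
    refine (sum_inter_le (T := Finset.Icc 2 k) (hcard a ha) (Finset.filter_subset _ _)
      (fun b hb => ?_) (fun _ => p) fun _ => hp0.le).trans_eq ?_
    · rw [Finset.mem_Icc]
      exact ⟨(Finset.mem_filter.mp hb).2,
        (Finset.card_le_card Finset.inter_subset_left).trans_eq (hcard a ha)⟩
    · simp only [mul_comm]
  · have hstep := sum_inter_le (J := (B a).erase a) (T := Finset.Ico 2 k) (hcard a ha)
      ((Finset.erase_subset _ _).trans (Finset.filter_subset _ _)) (fun b hb => by
        rw [Finset.mem_erase] at hb
        have hbI := Finset.mem_filter.mp hb.2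
        refine Finset.mem_Ico.mpr ⟨hbI.2, ?_⟩
        rw [← hcard a ha]
        refine Finset.card_lt_card (Finset.inter_subset_left.ssubset_of_ne fun h => hb.1 ?_)
        exact (Finset.eq_of_subset_of_card_le (Finset.inter_eq_left.mp h)
          (by rw [hcard a ha, hcard b hbI.1])).symm)
      (fun l => p * (((i : ℝ) + 1) * (k ^ 2) ^ i * (2 ^ l.choose 2 / 2 ^ k.choose 2)))
      (fun l => by positivity)
    refine (Finset.sum_le_sum fun b hb => ?_).trans (hstep.trans_eq ?_)
    · exact expect_inducesInd_mul_le i (by omega) (hcard a ha)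
        (hcard b (Finset.mem_filter.mp (Finset.mem_erase.mp hb).2).1)
    · simp only [Finset.mul_sum]
      exact Finset.sum_congr rfl fun l _ => by ring

lemma choose_sub_mul_pow_le {n k : ℕ} (hkn : k ≤ n) {l : ℕ} (hl : l ≤ k) :
    (n - l).choose (k - l) * n ^ l ≤ n.choose k * k ^ l := by
  induction l with
  | zero => simp
  | succ l ih =>
    obtain ⟨k', hk'⟩ : ∃ k', k - l = k' + 1 := ⟨k - (l + 1), by omega⟩
    obtain ⟨n', hn'⟩ : ∃ n', n - l = n' + 1 := ⟨n - (l + 1), by omega⟩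
    have ih := ih (by omega)
    rw [hk', hn'] at ih
    rw [show n - (l + 1) = n' by omega, show k - (l + 1) = k' by omega]
    have habs := Nat.add_one_mul_choose_eq n' k'
    have hkl : k = k' + 1 + l := by omega
    have hnl : n = n' + 1 + l := by omega
    have hle : n * (k' + 1) ≤ k * (n' + 1) := by nlinarith
    have hstep : n'.choose k' * n ≤ (n' + 1).choose (k' + 1) * k := by
      refine Nat.le_of_mul_le_mul_left ?_ (Nat.succ_pos n')
      calc (n' + 1) * (n'.choose k' * n) = (n' + 1) * n'.choose k' * n := by ring
        _ = (n' + 1).choose (k' + 1) * (n * (k' + 1)) := by rw [habs]; ring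
        _ ≤ (n' + 1).choose (k' + 1) * (k * (n' + 1)) := Nat.mul_le_mul_left _ hle
        _ = (n' + 1) * ((n' + 1).choose (k' + 1) * k) := by ring
    calc n'.choose k' * n ^ (l + 1) = n'.choose k' * n * n ^ l := by ring
      _ ≤ (n' + 1).choose (k' + 1) * k * n ^ l := Nat.mul_le_mul_right _ hstep
      _ = (n' + 1).choose (k' + 1) * n ^ l * k := by ring
      _ ≤ n.choose k * k ^ l * k := Nat.mul_le_mul_right _ ih
      _ = n.choose k * k ^ (l + 1) := by ring

lemma overlapCount_le {n k l : ℕ} (hn : 0 < n) (hkn : k ≤ n) (hl : l ≤ k) :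
    (overlapCount n k l : ℝ) ≤ n.choose k * ((k : ℝ) ^ 2 / n) ^ l := by
  have h1 : ((n - l).choose (k - l) : ℝ) * n ^ l ≤ n.choose k * k ^ l := by
    exact_mod_cast choose_sub_mul_pow_le hkn hl
  have h2 : (k.choose l : ℝ) ≤ k ^ l := by exact_mod_cast Nat.choose_le_pow k l
  rw [div_pow, mul_div_assoc', le_div_iff₀ (by positivity), overlapCount]
  push_cast
  calc (k.choose l : ℝ) * (n - l).choose (k - l) * n ^ l
      = k.choose l * ((n - l).choose (k - l) * n ^ l) := by ring
    _ ≤ k ^ l * (n.choose k * k ^ l) := by gcongr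
    _ = n.choose k * (k ^ 2) ^ l := by ring

lemma two_mul_choose_two (m : ℕ) : 2 * (m + 1).choose 2 = (m + 1) * m := by
  rw [Nat.choose_two_right, Nat.add_sub_cancel]
  exact Nat.mul_div_cancel' (by simpa [mul_comm] using (Nat.even_mul_succ_self m).two_dvd)

lemma choose_two_add (l j : ℕ) : (l + j).choose 2 = l.choose 2 + j.choose 2 + l * j := by
  induction j with
  | zero => simp
  | succ j ih =>
    have h (m : ℕ) : (m + 1).choose 2 = m + m.choose 2 := by
      rw [Nat.choose_succ_succ' m 1, Nat.choose_one_right]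
    rw [← add_assoc, h, h, ih]
    ring

lemma two_pow_le {n k l : ℕ} {R : ℝ} (hR : 1 ≤ R) (h2 : (2 : ℝ) ^ k ≤ R * n ^ 2)
    (hl : 2 * l ≤ k) : (2 : ℝ) ^ l ≤ R * n := by
  refine (sq_le_sq₀ (by positivity) (by positivity)).mp ?_
  calc ((2 : ℝ) ^ l) ^ 2 = 2 ^ (2 * l) := by rw [← pow_mul, mul_comm]
    _ ≤ 2 ^ k := pow_le_pow_right₀ one_le_two hl
    _ ≤ R * n ^ 2 := h2
    _ ≤ R ^ 2 * n ^ 2 := by gcongr; exact le_self_pow₀ hR two_ne_zero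
    _ = (R * n) ^ 2 := by ring

/-- Overlap terms for at most half-size intersections. -/
lemma overlap_small_le {n k l : ℕ} {R : ℝ} (hn : 0 < n) (hkn : k ≤ n) (hR : 1 ≤ R)
    (hkR : (k : ℝ) ^ 2 ≤ R) (h2 : (2 : ℝ) ^ k ≤ R * n ^ 2) (hRn : R ^ 3 ≤ n) (hl2 : 2 ≤ l)
    (hl : 2 * l ≤ k) :
    (overlapCount n k l : ℝ) * (2 ^ l.choose 2 / 2 ^ k.choose 2) ≤
      (n.choose k : ℝ) / 2 ^ k.choose 2 * (R ^ 3 / n) := by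
  have hn' : (0 : ℝ) < n := by exact_mod_cast hn
  obtain ⟨m, rfl⟩ : ∃ m, l = m + 1 := ⟨l - 1, by omega⟩
  have hx : ((k : ℝ) ^ 2 / n) ^ (m + 1) * 2 ^ (m + 1).choose 2 ≤ R ^ 3 / n := by
    refine (sq_le_sq₀ (by positivity) (by positivity)).mp ?_
    have hy : ((k : ℝ) ^ 2 / n) ^ 2 * 2 ^ m ≤ R ^ 3 / n := by
      have h2m : (2 : ℝ) ^ m ≤ R * n := two_pow_le hR h2 (by omega)
      calc ((k : ℝ) ^ 2 / n) ^ 2 * 2 ^ m ≤ (R / n) ^ 2 * (R * n) := by gcongr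
        _ = R ^ 3 / n := by field_simp
    have hone : R ^ 3 / n ≤ 1 := by rwa [div_le_one hn']
    calc (((k : ℝ) ^ 2 / n) ^ (m + 1) * 2 ^ (m + 1).choose 2) ^ 2
        = (((k : ℝ) ^ 2 / n) ^ 2 * 2 ^ m) ^ (m + 1) := by
          rw [mul_pow, mul_pow, ← pow_mul, ← pow_mul, ← pow_mul, ← pow_mul,
            mul_comm ((m + 1).choose 2), two_mul_choose_two, mul_comm (m + 1) 2,
            mul_comm (m + 1) m]
      _ ≤ (R ^ 3 / n) ^ (m + 1) := by gcongr
      _ ≤ (R ^ 3 / n) ^ 2 := pow_le_pow_of_le_one (by positivity) hone hl2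
  calc (overlapCount n k (m + 1) : ℝ) * (2 ^ (m + 1).choose 2 / 2 ^ k.choose 2)
      ≤ n.choose k * ((k : ℝ) ^ 2 / n) ^ (m + 1) * (2 ^ (m + 1).choose 2 / 2 ^ k.choose 2) := by
        gcongr
        exact overlapCount_le hn hkn (by omega)
    _ = (n.choose k : ℝ) / 2 ^ k.choose 2 *
        (((k : ℝ) ^ 2 / n) ^ (m + 1) * 2 ^ (m + 1).choose 2) := by ring
    _ ≤ _ := by gcongr

/-- Overlap terms for more than half-size intersections. -/
lemma overlap_large_le {n k l j : ℕ} {R : ℝ} (hn : 0 < n) (hR : 1 ≤ R)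
    (hkR : 4 * (k : ℝ) ^ 2 ≤ R) (h1 : (n : ℝ) ^ 2 ≤ R * 2 ^ k) (h2 : (2 : ℝ) ^ k ≤ R * n ^ 2)
    (hRn : R ^ 4 ≤ n) (hj1 : 1 ≤ j) (hj : 2 * j ≤ k) (hlj : l + j = k) :
    (overlapCount n k l : ℝ) * (2 ^ l.choose 2 / 2 ^ k.choose 2) ≤ R ^ 4 / n := by
  have hn' : (0 : ℝ) < n := by exact_mod_cast hn
  have hcount : (overlapCount n k l : ℝ) ≤ ((k : ℝ) * n) ^ j := by
    have hkl : k - l = j := by omega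
    have hsymm : k.choose l = k.choose j := by
      rw [← hkl, Nat.choose_symm (by omega)]
    have : overlapCount n k l ≤ k ^ j * n ^ j := by
      rw [overlapCount, hkl, hsymm]
      exact Nat.mul_le_mul (Nat.choose_le_pow _ _)
        ((Nat.choose_le_pow _ _).trans (Nat.pow_le_pow_left (Nat.sub_le _ _) _))
    rw [mul_pow]
    exact_mod_cast this
  have hx : ((k : ℝ) * n) ^ j / 2 ^ (j.choose 2 + l * j) ≤ R ^ 4 / n := by
    obtain ⟨m, rfl⟩ : ∃ m, j = m + 1 := ⟨j - 1, by omega⟩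
    rcases Nat.eq_zero_or_pos m with rfl | hm
    · have hk : 2 * (k : ℝ) ≤ R := by
        have : (1 : ℝ) ≤ k := by exact_mod_cast (by omega : 1 ≤ k)
        nlinarith
      have hpow : (2 : ℝ) ^ k = 2 ^ l * 2 := by rw [← hlj, zero_add, pow_succ]
      have hR4 : R * R ≤ R ^ 4 := by
        rw [← sq]
        exact pow_le_pow_right₀ hR (by norm_num)
      simp only [zero_add, pow_one, mul_one, Nat.reduceLT, Nat.choose_eq_zero_of_lt]
      rw [div_le_div_iff₀ (by positivity) hn']
      calc (k : ℝ) * n * n = k * n ^ 2 := by ring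
        _ ≤ k * (R * 2 ^ k) := by gcongr
        _ = 2 * k * R * 2 ^ l := by rw [hpow]; ring
        _ ≤ R * R * 2 ^ l := by gcongr
        _ ≤ R ^ 4 * 2 ^ l := by gcongr
    · refine (sq_le_sq₀ (by positivity) (by positivity)).mp ?_
      have hy : ((k : ℝ) * n) ^ 2 / 2 ^ (2 * l + m) ≤ R ^ 4 / n := by
        have h2m : (2 : ℝ) ^ (m + 1) ≤ R * n := two_pow_le hR h2 hj
        rw [div_le_div_iff₀ (by positivity) hn']
        have h4 : (n : ℝ) ^ 4 ≤ R ^ 2 * (2 ^ (2 * l + m) * (2 * (R * n))) := by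
          calc (n : ℝ) ^ 4 = (n ^ 2) ^ 2 := by ring
            _ ≤ (R * 2 ^ k) ^ 2 := by gcongr
            _ = R ^ 2 * (2 ^ (2 * l + m) * (2 * 2 ^ (m + 1))) := by rw [← hlj]; ring
            _ ≤ _ := by gcongr
        have h3 : (n : ℝ) ^ 3 ≤ 2 * R ^ 3 * 2 ^ (2 * l + m) := by
          refine le_of_mul_le_mul_right ?_ hn'
          calc (n : ℝ) ^ 3 * n = n ^ 4 := by ring
            _ ≤ _ := h4
            _ = _ := by ring
        calc ((k : ℝ) * n) ^ 2 * n = k ^ 2 * n ^ 3 := by ring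
          _ ≤ k ^ 2 * (2 * R ^ 3 * 2 ^ (2 * l + m)) := by gcongr
          _ = 2 * k ^ 2 * (R ^ 3 * 2 ^ (2 * l + m)) := by ring
          _ ≤ R * (R ^ 3 * 2 ^ (2 * l + m)) := by
              gcongr
              nlinarith [sq_nonneg (k : ℝ)]
          _ = R ^ 4 * 2 ^ (2 * l + m) := by ring
      have hone : R ^ 4 / n ≤ 1 := by rwa [div_le_one hn']
      have hexp : ((m + 1).choose 2 + l * (m + 1)) * 2 = (2 * l + m) * (m + 1) := by
        rw [add_mul, mul_comm ((m + 1).choose 2), two_mul_choose_two]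
        ring
      calc (((k : ℝ) * n) ^ (m + 1) / 2 ^ ((m + 1).choose 2 + l * (m + 1))) ^ 2
          = (((k : ℝ) * n) ^ 2 / 2 ^ (2 * l + m)) ^ (m + 1) := by
            rw [div_pow, div_pow, ← pow_mul, ← pow_mul, ← pow_mul, ← pow_mul, hexp,
              mul_comm (m + 1) 2]
        _ ≤ (R ^ 4 / n) ^ (m + 1) := by gcongr
        _ ≤ (R ^ 4 / n) ^ 2 := pow_le_pow_of_le_one (by positivity) hone (by omega)
  have hpow : (2 : ℝ) ^ l.choose 2 / 2 ^ k.choose 2 = (2 ^ (j.choose 2 + l * j))⁻¹ := by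
    rw [← hlj, choose_two_add, add_assoc, pow_add 2 (l.choose 2),
      div_mul_cancel_left₀ (by positivity)]
  rw [hpow, ← div_eq_mul_inv]
  exact (div_le_div_of_nonneg_right hcount (by positivity)).trans hx

/-- The Poisson approximation bound under explicit growth conditions on `k` and `i`. -/
lemma dTVPoisson_numZ_le_of_growth {n k i : ℕ} {R : ℝ} (hk : 2 ≤ k) (hkn : k ≤ n)
    (hi : i ≤ k.choose 2) (hkR : 4 * (k : ℝ) ^ 2 ≤ R) (h1 : (n : ℝ) ^ 2 ≤ R * 2 ^ k)
    (h2 : (2 : ℝ) ^ k ≤ R * n ^ 2) (hRn : R ^ 4 ≤ n) (hiR : ((i : ℝ) + 1) * (k ^ 2) ^ i ≤ R) :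
    dTVPoisson n (numZ n k i) (expZ n k i) ≤
      R ^ 6 / n * (expZ n k i ^ 2 + expZ n k i) := by
  have hn : 0 < n := by omega
  have hn1 : (1 : ℝ) ≤ n := by exact_mod_cast hn
  have hn' : (0 : ℝ) < n := by linarith
  have hk' : (2 : ℝ) ≤ k := by exact_mod_cast hk
  have hkR8 : 8 * (k : ℝ) ≤ R := by nlinarith
  have hR16 : 16 ≤ R := by linarith
  have hR1 : 1 ≤ R := by linarith
  have hR0 : 0 < R := by linarith
  have hk2R : (k : ℝ) ^ 2 ≤ R := by nlinarith [sq_nonneg (k : ℝ)]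
  have hRn3 : R ^ 3 ≤ n := (pow_le_pow_right₀ hR1 (by norm_num)).trans hRn
  have hR_n : R ≤ n := (le_self_pow₀ hR1 (by norm_num)).trans hRn
  refine (dTVPoisson_numZ_le hk hkn hi).trans ?_
  set lam := expZ n k i with hlam
  set p : ℝ := ((k.choose 2).choose i : ℝ) / 2 ^ k.choose 2 with hp
  have hlamp : lam = p * n.choose k := by rw [hlam, expZ, hp]; ring
  have hlam0 : 0 ≤ lam := by rw [hlamp]; positivity
  have hlam1 : (n.choose k : ℝ) / 2 ^ k.choose 2 ≤ lam := by
    rw [hlam, expZ]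
    gcongr
    have : (1 : ℝ) ≤ (k.choose 2).choose i := by exact_mod_cast Nat.choose_pos hi
    exact le_mul_of_one_le_right (by positivity) this
  have hsum1 : p * ∑ l ∈ Finset.Icc 2 k, (overlapCount n k l : ℝ) ≤ lam * (R ^ 3 / n) := by
    have hterm : ∀ l ∈ Finset.Icc 2 k, (overlapCount n k l : ℝ) ≤
        n.choose k * ((k : ℝ) ^ 2 / n) ^ 2 := by
      intro l hl
      rw [Finset.mem_Icc] at hl
      refine (overlapCount_le hn hkn hl.2).trans ?_
      gcongr ?_ * ?_
      exact pow_le_pow_of_le_one (by positivity)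
        ((div_le_one hn').mpr (hk2R.trans hR_n)) hl.1
    calc p * ∑ l ∈ Finset.Icc 2 k, (overlapCount n k l : ℝ)
        ≤ p * ((Finset.Icc 2 k).card • (n.choose k * ((k : ℝ) ^ 2 / n) ^ 2)) := by
          gcongr
          exact Finset.sum_le_card_nsmul _ _ _ hterm
      _ ≤ p * (R * (n.choose k * (R / n) ^ 2)) := by
          rw [nsmul_eq_mul, Nat.card_Icc]
          gcongr
          have : ((k + 1 - 2 : ℕ) : ℝ) ≤ k := by exact_mod_cast (by omega)
          linarith
      _ = lam * (R ^ 3 / n) * (1 / n) := by rw [hlamp]; field_simp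
      _ ≤ lam * (R ^ 3 / n) * 1 := by
          gcongr
          rwa [div_le_one hn']
      _ = _ := mul_one _
  have hsum2 : ∑ l ∈ Finset.Ico 2 k, (overlapCount n k l : ℝ) *
      (2 ^ l.choose 2 / 2 ^ k.choose 2) ≤ R / 8 * ((lam + 1) * (R ^ 4 / n)) := by
    have hterm : ∀ l ∈ Finset.Ico 2 k, (overlapCount n k l : ℝ) *
        (2 ^ l.choose 2 / 2 ^ k.choose 2) ≤ (lam + 1) * (R ^ 4 / n) := by
      intro l hl
      rw [Finset.mem_Ico] at hl
      rcases le_total (2 * l) k with hlk | hlk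
      · refine (overlap_small_le hn hkn hR1 hk2R h2 hRn3 hl.1 hlk).trans ?_
        gcongr
        · linarith
        · norm_num
      · refine (overlap_large_le (j := k - l) hn hR1 hkR h1 h2 hRn (by omega) (by omega)
          (by omega)).trans ?_
        exact le_mul_of_one_le_left (by positivity) (by linarith)
    refine (Finset.sum_le_card_nsmul _ _ _ hterm).trans ?_
    rw [nsmul_eq_mul, Nat.card_Ico]
    gcongr
    have : ((k - 2 : ℕ) : ℝ) ≤ k := by exact_mod_cast (by omega)
    linarith
  calc 2 * lam * (p * ∑ l ∈ Finset.Icc 2 k, (overlapCount n k l : ℝ) +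
        ((i : ℝ) + 1) * (k ^ 2) ^ i *
          ∑ l ∈ Finset.Ico 2 k, (overlapCount n k l : ℝ) * (2 ^ l.choose 2 / 2 ^ k.choose 2))
      ≤ 2 * lam * (lam * (R ^ 3 / n) + R * (R / 8 * ((lam + 1) * (R ^ 4 / n)))) := by gcongr
    _ = 2 * R ^ 3 / n * lam ^ 2 + R ^ 6 / 4 / n * (lam ^ 2 + lam) := by ring
    _ ≤ R ^ 6 / 2 / n * (lam ^ 2 + lam) + R ^ 6 / 4 / n * (lam ^ 2 + lam) := by
        gcongr
        · have : 16 ^ 3 ≤ R ^ 3 := by gcongr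
          nlinarith [pow_pos hR0 3]
        · linarith
    _ ≤ R ^ 6 / n * (lam ^ 2 + lam) := by
        have : 0 ≤ R ^ 6 / n * (lam ^ 2 + lam) := by positivity
        linear_combination this / 4

/-- The growth conditions on `k` and `i` hold when `log n` is large compared to `log log n`. -/
lemma dTVPoisson_numZ_le_rpow {C η : ℝ} {n k i : ℕ} (hη : 0 < η) (hη4 : 4 * η ≤ 1)
    (hL4 : 4 ≤ Real.log n) (hl1 : 1 ≤ Real.log (Real.log n))
    (h6l : 6 * Real.log (Real.log n) ≤ η * Real.log n)
    (hCl : C * Real.log (Real.log n) ≤ η * Real.log n)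
    (hk : |(k : ℝ) - 2 * Real.logb 2 n| ≤ C * Real.log (Real.log n))
    (hi : (i : ℝ) ≤ η / 6 * Real.log n / Real.log (Real.log n)) :
    dTVPoisson n (numZ n k i) (expZ n k i) ≤
      (n : ℝ) ^ (-1 + 6 * η) * (expZ n k i ^ 2 + expZ n k i) := by
  set L := Real.log n with hL_def
  set l := Real.log L with hl_def
  have hL0 : 0 < L := by linarith
  have hn0 : (0 : ℝ) < n := by
    refine lt_of_le_of_ne (Nat.cast_nonneg n) fun h => ?_
    rw [hL_def, ← h, Real.log_zero] at hL0
    exact hL0.false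
  have hnL : (n : ℝ) = Real.exp L := (Real.exp_log hn0).symm
  have hLl : L = Real.exp l := (Real.exp_log hL0).symm
  have hpow (x : ℝ) : (n : ℝ) ^ x = Real.exp (L * x) := Real.rpow_def_of_pos hn0 x
  have hηL : η * L ≤ L / 4 := by nlinarith
  have hlog2 := Real.log_two_gt_d9
  have hlog2' := Real.log_two_lt_d9
  have hlog2_pos : 0 < Real.log 2 := by linarith
  have hlogb : 2 * Real.logb 2 n = 2 * L / Real.log 2 := by rw [Real.logb, mul_div_assoc]
  rw [hlogb, abs_le] at hk
  have hk_up : (k : ℝ) ≤ 2 * L / Real.log 2 + η * L := by linarith [hk.2]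
  have hk_lo : 2 * L / Real.log 2 - η * L ≤ k := by linarith [hk.1]
  have hdiv_up : 2 * L / Real.log 2 ≤ 3 * L := by
    rw [div_le_iff₀ hlog2_pos]; nlinarith
  have hdiv_lo : 2 * L ≤ 2 * L / Real.log 2 := by
    rw [le_div_iff₀ hlog2_pos]; nlinarith
  have hcancel : 2 * L / Real.log 2 * Real.log 2 = 2 * L := div_mul_cancel₀ _ hlog2_pos.ne'
  have hηlog : η * L * Real.log 2 ≤ η * L := mul_le_of_le_one_right (by positivity) (by linarith)
  have hklog_up : k * Real.log 2 ≤ 2 * L + η * L := by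
    have := mul_le_mul_of_nonneg_right hk_up hlog2_pos.le
    rw [add_mul, hcancel] at this
    linarith
  have hklog_lo : 2 * L ≤ η * L + k * Real.log 2 := by
    have := mul_le_mul_of_nonneg_right hk_lo hlog2_pos.le
    rw [sub_mul, hcancel] at this
    linarith
  have hk_le : (k : ℝ) ≤ L ^ 2 := by nlinarith
  have hLk : L ≤ k := by linarith
  have hk4 : 4 ≤ k := by exact_mod_cast hL4.trans hLk
  have hLsq : L ^ 2 = Real.exp (2 * l) := by
    rw [two_mul, Real.exp_add, ← hLl, sq]
  have h2k : (2 : ℝ) ^ k = Real.exp (k * Real.log 2) := by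
    rw [Real.exp_nat_mul, Real.exp_log two_pos]
  have hnsq : (n : ℝ) ^ 2 = Real.exp (2 * L) := by
    rw [two_mul, Real.exp_add, ← hnL, sq]
  have hR : (n : ℝ) ^ η = Real.exp (η * L) := by rw [hpow, mul_comm]
  have hi_mul : (i : ℝ) * l ≤ η / 6 * L := by rwa [← le_div_iff₀ (by linarith)]
  have hbound := dTVPoisson_numZ_le_of_growth (n := n) (k := k) (i := i) (R := (n : ℝ) ^ η)
    (by omega) ?_ ?_ ?_ ?_ ?_ ?_ ?_
  · refine hbound.trans ?_
    have hlam : 0 ≤ expZ n k i := by unfold expZ; positivity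
    refine mul_le_mul_of_nonneg_right ?_ (by positivity)
    rw [hR, ← Real.exp_nat_mul, hpow, hnL, ← Real.exp_sub, Real.exp_le_exp]
    push_cast
    linarith
  · have : (k : ℝ) ≤ n := by
      rw [hnL]
      refine hk_le.trans ?_
      rw [hLsq, Real.exp_le_exp]
      linarith
    exact_mod_cast this
  · have hik : i ≤ k := by
      have : (i : ℝ) ≤ k := by
        have : (i : ℝ) ≤ i * l := le_mul_of_one_le_right (by positivity) hl1
        linarith
      exact_mod_cast this
    refine hik.trans ?_
    rw [Nat.choose_two_right, Nat.le_div_iff_mul_le two_pos]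
    exact Nat.mul_le_mul_left k (by omega)
  · calc 4 * (k : ℝ) ^ 2 ≤ L * (L ^ 2) ^ 2 := by gcongr
      _ = Real.exp (5 * l) := by
        rw [hLl, ← Real.exp_nat_mul, ← Real.exp_nat_mul, ← Real.exp_add]
        congr 1
        push_cast
        ring
      _ ≤ (n : ℝ) ^ η := by
        rw [hR, Real.exp_le_exp]
        linarith
  · rwa [hnsq, hR, h2k, ← Real.exp_add, Real.exp_le_exp]
  · rw [hnsq, hR, h2k, ← Real.exp_add, Real.exp_le_exp]
    linarith
  · rw [hR, ← Real.exp_nat_mul, hnL, Real.exp_le_exp]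
    push_cast
    linarith
  · have hi2 : (i : ℝ) + 1 ≤ (L ^ 2) ^ i := by
      have h : i + 1 ≤ k ^ i :=
        (Nat.lt_two_pow_self (n := i)).trans_le (Nat.pow_le_pow_left (by omega) i)
      calc (i : ℝ) + 1 ≤ (k : ℝ) ^ i := by exact_mod_cast h
        _ ≤ (L ^ 2) ^ i := by gcongr
    calc ((i : ℝ) + 1) * ((k : ℝ) ^ 2) ^ i ≤ (L ^ 2) ^ i * ((L ^ 2) ^ 2) ^ i := by gcongr
      _ = Real.exp (6 * (i * l)) := by
        rw [hLsq, ← Real.exp_nat_mul, ← Real.exp_nat_mul, ← Real.exp_nat_mul, ← Real.exp_add]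
        congr 1
        push_cast
        ring
      _ ≤ (n : ℝ) ^ η := by
        rw [hR, Real.exp_le_exp]
        linarith

theorem stmt7 (C ε : ℝ) (hC : 0 < C) (hε : 0 < ε) :
    ∃ δ : ℝ, 0 < δ ∧ ∃ N : ℕ, ∀ n : ℕ, N ≤ n → ∀ k i : ℕ,
      |(k : ℝ) - 2 * Real.logb 2 n| ≤ C * Real.log (Real.log n) →
      (i : ℝ) ≤ δ * Real.log n / Real.log (Real.log n) →
      dTVPoisson n (numZ n k i) (expZ n k i) ≤
        (n : ℝ) ^ (-1 + ε) * (expZ n k i ^ 2 + expZ n k i) := by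
  set η := min (ε / 6) (1 / 4) with hη_def
  have hη : 0 < η := lt_min (by positivity) (by norm_num)
  have hηε : 6 * η ≤ ε := by linarith [min_le_left (ε / 6) (1 / 4)]
  have hη4 : 4 * η ≤ 1 := by linarith [min_le_right (ε / 6) (1 / 4)]
  have hL : Filter.Tendsto (fun n : ℕ => Real.log n) Filter.atTop Filter.atTop :=
    Real.tendsto_log_atTop.comp tendsto_natCast_atTop_atTop
  have hlittle (c : ℝ) (hc : 0 < c) :
      ∀ᶠ n : ℕ in Filter.atTop, Real.log (Real.log n) ≤ c * Real.log n := by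
    filter_upwards [hL.eventually (Real.isLittleO_log_id_atTop.bound hc),
      hL.eventually_ge_atTop 0] with n hn hn0
    simpa [abs_of_nonneg hn0] using (le_abs_self _).trans hn
  obtain ⟨N, hN⟩ := Filter.eventually_atTop.mp ((hL.eventually_ge_atTop 4).and
    (((Real.tendsto_log_atTop.comp hL).eventually_ge_atTop 1).and
      ((hlittle (η / 6) (by positivity)).and (hlittle (η / C) (by positivity)))))
  refine ⟨η / 6, by positivity, N, fun n hn k i hk hi => ?_⟩
  obtain ⟨hL4, hl1, hl6, hlC⟩ := hN n hn
  have hCl : C * Real.log (Real.log n) ≤ η * Real.log n := by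
    calc C * Real.log (Real.log n) ≤ C * (η / C * Real.log n) := by gcongr
      _ = η * Real.log n := by field_simp
  refine (dTVPoisson_numZ_le_rpow hη hη4 hL4 hl1 (by linarith) hCl hk hi).trans ?_
  have hn1 : (1 : ℝ) ≤ n := by
    by_contra! h
    linarith [Real.log_nonpos (Nat.cast_nonneg n) h.le]
  have hlam : 0 ≤ expZ n k i := by unfold expZ; positivity
  gcongr
end
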